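/- Let Ω ⊆ ℂⁿ be a bounded domain and let f, q ∈ ℳ with q tame. Then S(f + q) = S f everywhere on Ω. -/

import Mathlib

open Complex Polynomial Filter Set Topology

noncomputable section

/-- `u` is plurisubharmonic on `Ω ⊆ ℂⁿ`: it is upper semicontinuous on `Ω`, takes values in
`[-∞, ∞)`, is not identically `-∞`, and on every closed disc of every complex line contained
in `Ω` it satisfies the maximum principle against real parts of complex polynomials
(an equivalent formulation of subharmonicity of the restriction to every complex line). -/
def IsPSH {n : ℕ} (Ω : Set (Fin n → ℂ)) (u : (Fin n → ℂ) → EReal) : Prop :=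
  UpperSemicontinuousOn u Ω ∧
  (∀ z ∈ Ω, u z ≠ ⊤) ∧
  (∃ z ∈ Ω, u z ≠ ⊥) ∧
  ∀ z ∈ Ω, ∀ w : Fin n → ℂ, ∀ r : ℝ, 0 < r →
    (∀ ζ : ℂ, ‖ζ‖ ≤ r → z + ζ • w ∈ Ω) →
    ∀ p : Polynomial ℂ,
      (∀ ζ : ℂ, ‖ζ‖ = r → u (z + ζ • w) ≤ (((p.eval ζ).re : ℝ) : EReal)) →
      ∀ ζ : ℂ, ‖ζ‖ ≤ r → u (z + ζ • w) ≤ (((p.eval ζ).re : ℝ) : EReal)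

/-- `v` is plurisuperharmonic on `Ω` iff `-v` is plurisubharmonic on `Ω`. -/
def IsPSupH {n : ℕ} (Ω : Set (Fin n → ℂ)) (v : (Fin n → ℂ) → EReal) : Prop :=
  IsPSH Ω (fun z => -(v z))

/-- `f` belongs to the class `ℳ`: `f : Ω → [0, +∞]` admits a plurisuperharmonic
majorant on `Ω`. -/
def MemM {n : ℕ} (Ω : Set (Fin n → ℂ)) (f : (Fin n → ℂ) → EReal) : Prop :=
  (∀ z ∈ Ω, 0 ≤ f z) ∧ ∃ v, IsPSupH Ω v ∧ ∀ z ∈ Ω, f z ≤ v z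

/-- The reduced function `R_λ f`: the pointwise infimum of all plurisuperharmonic
majorants of `(f - λ)⁺ = max {f - λ, 0}` on `Ω`. -/
def Rop {n : ℕ} (Ω : Set (Fin n → ℂ)) (f : (Fin n → ℂ) → EReal) (lam : ℝ)
    (z : Fin n → ℂ) : EReal :=
  sInf { y | ∃ v, IsPSupH Ω v ∧ (∀ ζ ∈ Ω, max (f ζ - (lam : EReal)) 0 ≤ v ζ) ∧ y = v z }

/-- Lower semicontinuous regularization of `g` relative to the set `A`:
`g_*(z) = liminf_{A ∋ ζ → z} g(ζ)`. -/
def lscReg {n : ℕ} (A : Set (Fin n → ℂ)) (g : (Fin n → ℂ) → EReal)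
    (z : Fin n → ℂ) : EReal :=
  liminf g (nhdsWithin z A)

/-- Upper semicontinuous regularization of `g` relative to the set `A`:
`g*(z) = limsup_{A ∋ ζ → z} g(ζ)`. -/
def uscReg {n : ℕ} (A : Set (Fin n → ℂ)) (g : (Fin n → ℂ) → EReal)
    (z : Fin n → ℂ) : EReal :=
  limsup g (nhdsWithin z A)

/-- `S_λ f`: the lower semicontinuous regularization of `R_λ f` on `Ω`. -/
def Slam {n : ℕ} (Ω : Set (Fin n → ℂ)) (f : (Fin n → ℂ) → EReal) (lam : ℝ) :
    (Fin n → ℂ) → EReal :=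
  lscReg Ω (Rop Ω f lam)

/-- The operator `S`: the lower semicontinuous regularization of
`lim_{λ → ∞} S_λ f`; since `λ ↦ S_λ f` is decreasing on `λ ≥ 0`, this limit is the
infimum over `λ ≥ 0`. -/
def Sop {n : ℕ} (Ω : Set (Fin n → ℂ)) (f : (Fin n → ℂ) → EReal) :
    (Fin n → ℂ) → EReal :=
  lscReg Ω (fun z => ⨅ (lam : ℝ) (_ : 0 ≤ lam), Slam Ω f lam z)

/-- `f` is tame on `Ω` if `S f ≡ 0`. -/
def Tame {n : ℕ} (Ω : Set (Fin n → ℂ)) (f : (Fin n → ℂ) → EReal) : Prop :=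
  ∀ z ∈ Ω, Sop Ω f z = 0

/-- `E` is a pluripolar subset of `Ω`: `E ⊆ {w = -∞}` for some plurisubharmonic `w` on `Ω`. -/
def Pluripolar {n : ℕ} (Ω : Set (Fin n → ℂ)) (E : Set (Fin n → ℂ)) : Prop :=
  E ⊆ Ω ∧ ∃ w, IsPSH Ω w ∧ ∀ z ∈ E, w z = ⊥

open MeasureTheory ENNReal

/-- Local lower semicontinuous regularization with values in `[0, ∞]`. -/
def lowerReg {E : Type*} [TopologicalSpace E] (w : E → ℝ≥0∞) (z : E) : ℝ≥0∞ :=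
  liminf w (𝓝 z)

/-- `w` satisfies the (lower integral) super-mean value inequality on balls contained in `Ω`. -/
def BallSuperMean {n : ℕ} (Ω : Set (Fin n → ℂ)) (w : (Fin n → ℂ) → ℝ≥0∞) : Prop :=
  ∀ z r, 0 < r → Metric.ball z r ⊆ Ω →
    ∫⁻ y in Metric.ball z r, w y ≤ volume (Metric.ball z r) * w z

section LowerReg

variable {E : Type*} [TopologicalSpace E]

theorem lowerReg_le (w : E → ℝ≥0∞) (z : E) : lowerReg w z ≤ w z := by
  refine (liminf_le_liminf_of_le (pure_le_nhds z)).trans ?_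
  simp [liminf_eq]

theorem eventually_lt_of_lt_lowerReg {w : E → ℝ≥0∞} {z : E} {c : ℝ≥0∞} (h : c < lowerReg w z) :
    ∀ᶠ y in 𝓝 z, c < w y :=
  eventually_lt_of_lt_liminf h

theorem lowerSemicontinuous_lowerReg (w : E → ℝ≥0∞) : LowerSemicontinuous (lowerReg w) := by
  intro z c hc
  obtain ⟨d, hcd, hd⟩ := exists_between hc
  filter_upwards [eventually_eventually_nhds.2 (eventually_lt_of_lt_lowerReg hd)] with y hy
  exact hcd.trans_le (le_liminf_of_le (by isBoundedDefault) (hy.mono fun _ h => h.le))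

theorem lowerReg_eq_of_lsc {w : E → ℝ≥0∞} {z : E} (h : LowerSemicontinuousAt w z) :
    lowerReg w z = w z :=
  le_antisymm (lowerReg_le w z) (lowerSemicontinuousAt_iff_le_liminf.1 h)

theorem lowerReg_lowerReg (w : E → ℝ≥0∞) : lowerReg (lowerReg w) = lowerReg w :=
  funext fun z => lowerReg_eq_of_lsc (lowerSemicontinuous_lowerReg w z)

end LowerReg

section BallSuperMean

variable {n : ℕ} {Ω : Set (Fin n → ℂ)} {w : (Fin n → ℂ) → ℝ≥0∞}

theorem volume_ball_ne_zero (z : Fin n → ℂ) {r : ℝ} (hr : 0 < r) :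
    volume (Metric.ball z r) ≠ 0 :=
  (Metric.measure_ball_pos volume z hr).ne'

theorem volume_ball_ne_top (z : Fin n → ℂ) (r : ℝ) : volume (Metric.ball z r) ≠ ∞ :=
  measure_ball_lt_top.ne

/-- A super-mean function dominates its ball averages even after regularization. -/
theorem BallSuperMean.lintegral_le_lowerReg (hw : BallSuperMean Ω w) {z : Fin n → ℂ} {r : ℝ}
    (hr : 0 < r) (hball : Metric.ball z r ⊆ Ω) :
    ∫⁻ y in Metric.ball z r, w y ≤ volume (Metric.ball z r) * lowerReg w z := by
  have key : ∀ ρ < r, ∫⁻ y in Metric.ball z ρ, w y ≤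
      volume (Metric.ball z r) * lowerReg w z := by
    intro ρ hρ
    rw [mul_comm, ← ENNReal.div_le_iff (volume_ball_ne_zero z hr) (volume_ball_ne_top z r)]
    refine le_liminf_of_le (by isBoundedDefault) ?_
    have h1 : 0 < min ((r - ρ) / 2) (r / 2) := by
      apply lt_min <;> linarith
    filter_upwards [Metric.ball_mem_nhds z h1] with y hy
    have hy' : dist y z < min ((r - ρ) / 2) (r / 2) := hy
    have hy1 := lt_of_lt_of_le hy' (min_le_left _ _)
    have hy2 := lt_of_lt_of_le hy' (min_le_right _ _)
    rw [ENNReal.div_le_iff (volume_ball_ne_zero z hr) (volume_ball_ne_top z r), mul_comm]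
    calc ∫⁻ y in Metric.ball z ρ, w y ≤ ∫⁻ y in Metric.ball y (r - dist y z), w y :=
          lintegral_mono_set (Metric.ball_subset_ball' (by rw [dist_comm z y]; linarith))
      _ ≤ volume (Metric.ball y (r - dist y z)) * w y :=
          hw _ _ (by linarith) ((Metric.ball_subset_ball' (by linarith)).trans hball)
      _ ≤ volume (Metric.ball z r) * w y := by
          gcongr
          exact Metric.ball_subset_ball' (by linarith)
  have hU : Metric.ball z r = ⋃ k : ℕ, Metric.ball z (r - 1 / ((k : ℝ) + 1)) := by
    ext y
    simp only [Metric.mem_ball, mem_iUnion]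
    constructor
    · intro h
      obtain ⟨k, hk⟩ := exists_nat_one_div_lt (sub_pos.2 h)
      exact ⟨k, by linarith⟩
    · rintro ⟨k, hk⟩
      have : 0 < 1 / ((k : ℝ) + 1) := by positivity
      linarith
  have hmono : Monotone fun k : ℕ => Metric.ball z (r - 1 / ((k : ℝ) + 1)) := by
    intro i j hij
    refine Metric.ball_subset_ball ?_
    have := Nat.one_div_le_one_div (α := ℝ) hij
    linarith
  conv_lhs => rw [hU]
  rw [setLIntegral_iUnion_of_directed _ hmono.directed_le]
  refine iSup_le fun k => key _ ?_
  have : 0 < 1 / ((k : ℝ) + 1) := by positivity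
  linarith

theorem BallSuperMean.lowerReg (hw : BallSuperMean Ω w) : BallSuperMean Ω (lowerReg w) :=
  fun _ _ hr hball => (lintegral_mono fun y => lowerReg_le w y).trans
    (hw.lintegral_le_lowerReg hr hball)

theorem BallSuperMean.iInf {ι : Sort*} {v : ι → (Fin n → ℂ) → ℝ≥0∞}
    (hv : ∀ i, BallSuperMean Ω (v i)) : BallSuperMean Ω (fun z => ⨅ i, v i z) := by
  intro z r hr hball
  rw [ENNReal.mul_iInf_of_ne (volume_ball_ne_zero z hr) (volume_ball_ne_top z r)]
  exact le_iInf fun i => (lintegral_mono fun y => iInf_le _ i).trans (hv i z r hr hball)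

theorem BallSuperMean.congr {v : (Fin n → ℂ) → ℝ≥0∞} (hw : BallSuperMean Ω w)
    (h : ∀ z ∈ Ω, v z = w z) : BallSuperMean Ω v := by
  intro z r hr hball
  rw [h z (hball (Metric.mem_ball_self hr)), setLIntegral_congr_fun measurableSet_ball
    (fun y hy => h y (hball hy))]
  exact hw z r hr hball

/-- A bound on small ball averages passes to the regularization. -/
theorem lowerReg_le_of_lintegral_le (hΩ : IsOpen Ω) {z : Fin n → ℂ} (hz : z ∈ Ω) {c : ℝ≥0∞}
    (h : ∀ r, 0 < r → Metric.ball z r ⊆ Ω →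
      ∫⁻ y in Metric.ball z r, w y ≤ volume (Metric.ball z r) * c) :
    lowerReg w z ≤ c := by
  refine le_of_forall_lt fun d hd => ?_
  obtain ⟨e, hde, he⟩ := exists_between hd
  obtain ⟨r, hr, hrs⟩ := Metric.mem_nhds_iff.1 ((eventually_lt_of_lt_lowerReg he).and (hΩ.mem_nhds hz))
  have h1 := h r hr fun y hy => (hrs hy).2
  have h2 : volume (Metric.ball z r) * e ≤ ∫⁻ y in Metric.ball z r, w y := by
    rw [mul_comm, ← setLIntegral_const]
    exact setLIntegral_mono' measurableSet_ball fun y hy => (hrs hy).1.le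
  refine hde.trans_le ?_
  exact (ENNReal.mul_le_mul_iff_right (volume_ball_ne_zero z hr) (volume_ball_ne_top z r)).1
    (h2.trans h1)

theorem lowerReg_le_add (hΩ : IsOpen Ω) {a b c : (Fin n → ℂ) → ℝ≥0∞}
    (hb : BallSuperMean Ω b) (hc : BallSuperMean Ω c) (hcm : Measurable c)
    (habc : ∀ z ∈ Ω, a z ≤ b z + c z) {z : Fin n → ℂ} (hz : z ∈ Ω) :
    lowerReg a z ≤ lowerReg b z + lowerReg c z := by
  refine lowerReg_le_of_lintegral_le hΩ hz fun r hr hball => ?_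
  calc ∫⁻ y in Metric.ball z r, a y ≤ ∫⁻ y in Metric.ball z r, (b y + c y) :=
        setLIntegral_mono' measurableSet_ball fun y hy => habc y (hball hy)
    _ = (∫⁻ y in Metric.ball z r, b y) + ∫⁻ y in Metric.ball z r, c y :=
        lintegral_add_right _ hcm
    _ ≤ _ := by
        rw [mul_add]
        exact add_le_add (hb.lintegral_le_lowerReg hr hball) (hc.lintegral_le_lowerReg hr hball)

end BallSuperMean

section Circle

/-- The standard parametrization of the unit circle by `ℝ / ℤ`. -/
def circlePoint (t : UnitAddCircle) : ℂ := AddCircle.toCircle t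

theorem norm_circlePoint (t : UnitAddCircle) : ‖circlePoint t‖ = 1 :=
  Circle.norm_coe _

theorem continuous_circlePoint : Continuous circlePoint :=
  continuous_subtype_val.comp AddCircle.continuous_toCircle

theorem exists_circlePoint_eq {ζ : ℂ} (hζ : ‖ζ‖ = 1) : ∃ t, circlePoint t = ζ := by
  obtain ⟨t, ht⟩ := (AddCircle.homeomorphCircle (T := 1) one_ne_zero).surjective
    ⟨ζ, mem_sphere_zero_iff_norm.2 hζ⟩
  rw [AddCircle.homeomorphCircle_apply] at ht
  exact ⟨t, congrArg Subtype.val ht⟩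

theorem fourier_natCast_eq_circlePoint_pow (k : ℕ) (t : UnitAddCircle) :
    fourier (k : ℤ) t = circlePoint t ^ k := by
  simp [circlePoint, fourier_apply, AddCircle.toCircle_nsmul]


/-- A complex-valued function on the circle is, up to real parts of its multiples, the boundary
value of polynomials. -/
theorem exists_polynomial_re_eq_of_mem_span_fourier {F : C(UnitAddCircle, ℂ)}
    (hF : F ∈ Submodule.span ℂ (range (fourier (T := 1)))) (c : ℂ) :
    ∃ p : Polynomial ℂ, ∀ t : UnitAddCircle,
      (p.eval (circlePoint t)).re = (c * F t).re := by
  induction hF using Submodule.span_induction generalizing c with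
  | mem F hF =>
    obtain ⟨m, rfl⟩ := hF
    obtain ⟨k, rfl | rfl⟩ := m.eq_nat_or_neg
    · refine ⟨Polynomial.C c * Polynomial.X ^ k, fun t => ?_⟩
      rw [fourier_natCast_eq_circlePoint_pow]
      simp
    · refine ⟨Polynomial.C (star c) * Polynomial.X ^ k, fun t => ?_⟩
      rw [fourier_neg, fourier_natCast_eq_circlePoint_pow, ← Complex.conj_re]
      simp
  | zero => exact ⟨0, fun t => by simp⟩
  | add F G _ _ hF hG =>
    obtain ⟨p, hp⟩ := hF c
    obtain ⟨q, hq⟩ := hG c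
    exact ⟨p + q, fun t => by simp [hp, hq, mul_add]⟩
  | smul a F _ hF =>
    obtain ⟨p, hp⟩ := hF (c * a)
    exact ⟨p, fun t => by simp [hp, mul_assoc]⟩

/-- Real parts of polynomials are uniformly dense in the continuous real functions on the
circle. -/
theorem exists_polynomial_re_near (h : C(UnitAddCircle, ℝ)) {δ : ℝ} (hδ : 0 < δ) :
    ∃ p : Polynomial ℂ, ∀ t : UnitAddCircle,
      |(p.eval (circlePoint t)).re - h t| < δ := by
  let H : C(UnitAddCircle, ℂ) := ⟨fun t => (h t : ℂ), by fun_prop⟩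
  have hH : H ∈ (Submodule.span ℂ (range (fourier (T := 1)))).topologicalClosure := by
    rw [span_fourier_closure_eq_top]; trivial
  obtain ⟨F, hF, hFH⟩ := Metric.mem_closure_iff.1 hH δ hδ
  obtain ⟨p, hp⟩ := exists_polynomial_re_eq_of_mem_span_fourier hF 1
  refine ⟨p, fun t => ?_⟩
  rw [hp]
  have h1 := (ContinuousMap.dist_lt_iff hδ).1 hFH t
  have h2 : (1 * F t).re - h t = (F t - H t).re := by simp [H]
  rw [h2]
  refine (Complex.abs_re_le_norm _).trans_lt ?_
  rwa [← dist_eq_norm, dist_comm]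

theorem exists_continuous_between {X : Type*} [TopologicalSpace X] [NormalSpace X]
    [ParacompactSpace X] [T2Space X] {φ ψ : X → EReal} (hφ : UpperSemicontinuous φ)
    (hψ : LowerSemicontinuous ψ) (h : ∀ x, φ x < ψ x) :
    ∃ g : C(X, ℝ), ∀ x, φ x < g x ∧ (g x : EReal) < ψ x := by
  refine exists_continuous_forall_mem_convex_of_local_const
    (t := fun x => {c : ℝ | φ x < c ∧ (c : EReal) < ψ x}) (fun x => ?_) fun x => ?_
  · refine (OrdConnected.mk fun a ha b hb c hc => ?_).convex
    exact ⟨ha.1.trans_le (EReal.coe_le_coe_iff.2 hc.1),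
      hb.2.trans_le' (EReal.coe_le_coe_iff.2 hc.2)⟩
  · obtain ⟨c, hc1, hc2⟩ := EReal.lt_iff_exists_real_btwn.1 (h x)
    exact ⟨c, (hφ x _ hc1).and (hψ x _ hc2)⟩

/-- Insertion of the real part of a polynomial between two functions on the circle. -/
theorem exists_polynomial_re_between {φ ψ : UnitAddCircle → EReal}
    (hφ : UpperSemicontinuous φ) (hψ : LowerSemicontinuous ψ) (h : ∀ x, φ x < ψ x) :
    ∃ p : Polynomial ℂ, ∀ t : UnitAddCircle,
      φ t < ((p.eval (circlePoint t)).re : ℝ) ∧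
      (((p.eval (circlePoint t)).re : ℝ) : EReal) < ψ t := by
  obtain ⟨g, hg⟩ := exists_continuous_between hφ hψ h
  obtain ⟨k, hk⟩ := exists_continuous_between (ψ := fun x => (g x : EReal)) hφ
    (continuous_coe_real_ereal.comp g.continuous).lowerSemicontinuous fun x => (hg x).1
  have hkg : ∀ x, k x < g x := fun x => EReal.coe_lt_coe_iff.1 (hk x).2
  obtain ⟨x₀, -, hx₀⟩ := isCompact_univ.exists_isMinOn univ_nonempty
    ((g - k).continuous.continuousOn (s := univ))
  have hδ : 0 < (g x₀ - k x₀) / 2 := by linarith [hkg x₀]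
  obtain ⟨p, hp⟩ := exists_polynomial_re_near ((1 / 2 : ℝ) • (g + k)) hδ
  refine ⟨p, fun t => ?_⟩
  have h1 : g x₀ - k x₀ ≤ g t - k t := hx₀ (mem_univ t)
  have h2 := abs_lt.1 (hp t)
  simp only [ContinuousMap.smul_apply, ContinuousMap.add_apply, smul_eq_mul] at h2
  constructor
  · refine (hk t).1.trans (EReal.coe_lt_coe_iff.2 ?_)
    linarith [h2.1]
  · refine lt_trans (EReal.coe_lt_coe_iff.2 ?_) (hg t).2
    linarith [h2.2]

theorem integral_polynomial_circlePoint (p : Polynomial ℂ) :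
    ∫ t : UnitAddCircle, p.eval (circlePoint t) ∂AddCircle.haarAddCircle
      = p.eval 0 := by
  have hint : ∀ q : Polynomial ℂ, Integrable
      (fun t : UnitAddCircle => q.eval (circlePoint t)) AddCircle.haarAddCircle := by
    intro q
    have : Continuous fun t : UnitAddCircle => q.eval (circlePoint t) :=
      q.continuous.comp continuous_circlePoint
    exact this.integrable_of_hasCompactSupport (HasCompactSupport.of_compactSpace _)
  induction p using Polynomial.induction_on' with
  | add p q hp hq =>
    simp only [Polynomial.eval_add]
    rw [integral_add (hint p) (hint q), hp, hq]
  | monomial k a =>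
    have h1 := congrFun (fourierCoeff_fourier (T := 1) k) 0
    simp only [fourierCoeff, neg_zero, fourier_zero, one_smul] at h1
    simp only [Polynomial.eval_monomial]
    rw [integral_const_mul]
    simp only [← fourier_natCast_eq_circlePoint_pow, h1]
    rcases k with _ | k
    · simp
    · rw [Pi.single_eq_of_ne (by omega)]; simp

end Circle

/-- A nonnegative lower semicontinuous function on the circle has mean at most `a` as soon as `a`
bounds the central values of all polynomial minorants. -/
theorem lintegral_circle_le {g : UnitAddCircle → EReal} (hg : LowerSemicontinuous g)
    (hg0 : ∀ t, 0 ≤ g t) {a : EReal}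
    (ha : ∀ p : Polynomial ℂ,
      (∀ t : UnitAddCircle, (((p.eval (circlePoint t)).re : ℝ) : EReal) ≤ g t) →
      (((p.eval 0).re : ℝ) : EReal) ≤ a) :
    ∫⁻ t, (g t).toENNReal ∂AddCircle.haarAddCircle ≤ a.toENNReal := by
  rw [lintegral_eq_nnreal]
  refine iSup₂_le fun s hs => ?_
  rw [SimpleFunc.map_lintegral, ← SimpleFunc.map_lintegral, ← SimpleFunc.lintegral_eq_lintegral]
  have hfin : ∫⁻ t, (s t : ℝ≥0∞) ∂(AddCircle.haarAddCircle (T := 1)) ≠ ∞ := by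
    obtain ⟨C, hC⟩ := s.exists_forall_le
    refine ((lintegral_mono fun t => ENNReal.coe_le_coe.2 (hC t)).trans_lt ?_).ne
    simp
  refine ENNReal.le_of_forall_pos_le_add fun ε hε _ => ?_
  have hε2 : (0 : ℝ) < ε / 2 := by positivity
  obtain ⟨u, hus, huc, hu⟩ := s.exists_upperSemicontinuous_le_lintegral_le hfin
    (ε := ENNReal.ofReal (ε / 2)) (ENNReal.ofReal_pos.2 hε2).ne'
  have hφ : UpperSemicontinuous fun t => (((u t : ℝ) - ε / 2 : ℝ) : EReal) := by
    have hc : Continuous fun x : NNReal => (((x : ℝ) - ε / 2 : ℝ) : EReal) :=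
      continuous_coe_real_ereal.comp (by fun_prop)
    refine hc.comp_upperSemicontinuous huc fun x y hxy => ?_
    exact EReal.coe_le_coe_iff.2 (sub_le_sub_right (NNReal.coe_le_coe.2 hxy) _)
  obtain ⟨p, hp⟩ := exists_polynomial_re_between hφ hg fun t => by
    have h1 : ((u t : ℝ) : EReal) ≤ g t := by
      rw [← EReal.coe_toENNReal (hg0 t)]
      have := (ENNReal.coe_le_coe.2 (hus t)).trans (hs t)
      exact EReal.coe_ennreal_le_coe_ennreal_iff.2 this
    exact (EReal.coe_lt_coe_iff.2 (by linarith)).trans_le h1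
  have hpa := ha p fun t => (hp t).2.le
  have hcont : Continuous fun t : UnitAddCircle => p.eval (circlePoint t) :=
    p.continuous.comp continuous_circlePoint
  have hint : Integrable (fun t : UnitAddCircle => p.eval (circlePoint t))
      AddCircle.haarAddCircle :=
    hcont.integrable_of_hasCompactSupport (HasCompactSupport.of_compactSpace _)
  have hre : Integrable (fun t : UnitAddCircle => (p.eval (circlePoint t)).re)
      AddCircle.haarAddCircle := hint.re
  have hup : ∀ t, (u t : ℝ) ≤ (p.eval (circlePoint t)).re + ε / 2 := fun t => by
    have := EReal.coe_lt_coe_iff.1 (hp t).1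
    linarith
  have hmean : ∫ t : UnitAddCircle, ((p.eval (circlePoint t)).re + ε / 2 : ℝ)
      ∂AddCircle.haarAddCircle = (p.eval 0).re + ε / 2 := by
    have h1 := integral_re hint
    simp only [RCLike.re_to_complex] at h1
    rw [integral_add hre (integrable_const _), integral_const, h1,
      integral_polynomial_circlePoint p]
    simp
  have hu' : ∫⁻ t, (u t : ℝ≥0∞) ∂AddCircle.haarAddCircle ≤
      a.toENNReal + ENNReal.ofReal (ε / 2) := by
    calc ∫⁻ t, (u t : ℝ≥0∞) ∂AddCircle.haarAddCircle
        ≤ ∫⁻ t : UnitAddCircle, ENNReal.ofReal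
            ((p.eval (circlePoint t)).re + ε / 2) ∂AddCircle.haarAddCircle := by
          refine lintegral_mono fun t => ?_
          rw [← ENNReal.ofReal_coe_nnreal]
          exact ENNReal.ofReal_le_ofReal (hup t)
      _ = ENNReal.ofReal ((p.eval 0).re + ε / 2) := by
          rw [← hmean, ofReal_integral_eq_lintegral_ofReal]
          · exact hre.add (integrable_const _)
          · exact Filter.Eventually.of_forall fun t => (u t).2.trans (hup t)
      _ ≤ ENNReal.ofReal (p.eval 0).re + ENNReal.ofReal (ε / 2) := ENNReal.ofReal_add_le
      _ ≤ a.toENNReal + ENNReal.ofReal (ε / 2) := by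
          gcongr
          exact EReal.toENNReal_le_toENNReal hpa
  refine hu.trans ((add_le_add_left hu' _).trans ?_)
  rw [add_assoc, ← ENNReal.ofReal_add hε2.le hε2.le, add_halves, ENNReal.ofReal_coe_nnreal]

section PSupH

variable {n : ℕ} {Ω : Set (Fin n → ℂ)} {v : (Fin n → ℂ) → EReal}

theorem IsPSupH.lowerSemicontinuousOn (hv : IsPSupH Ω v) : LowerSemicontinuousOn v Ω := by
  intro z hz c hc
  filter_upwards [hv.1 z hz (-c) (EReal.neg_lt_neg_iff.2 hc)] with y hy
  exact EReal.neg_lt_neg_iff.1 hy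

theorem IsPSupH.re_le (hv : IsPSupH Ω v) {z : Fin n → ℂ} (hz : z ∈ Ω) (w : Fin n → ℂ) {r : ℝ}
    (hr : 0 < r) (hd : ∀ ζ : ℂ, ‖ζ‖ ≤ r → z + ζ • w ∈ Ω) (p : Polynomial ℂ)
    (hp : ∀ ζ : ℂ, ‖ζ‖ = r → (((p.eval ζ).re : ℝ) : EReal) ≤ v (z + ζ • w)) {ζ : ℂ}
    (hζ : ‖ζ‖ ≤ r) : (((p.eval ζ).re : ℝ) : EReal) ≤ v (z + ζ • w) := by
  have := hv.2.2.2 z hz w r hr hd (-p) (fun ζ hζ => by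
    simpa using EReal.neg_le_neg_iff.2 (hp ζ hζ)) ζ hζ
  rw [Polynomial.eval_neg, Complex.neg_re, EReal.coe_neg, EReal.neg_le_neg_iff] at this
  exact this

theorem IsPSupH.lintegral_circle_le (hv : IsPSupH Ω v) (h0 : ∀ z ∈ Ω, 0 ≤ v z)
    {z : Fin n → ℂ} {w : Fin n → ℂ} (hd : ∀ ζ : ℂ, ‖ζ‖ ≤ 1 → z + ζ • w ∈ Ω) :
    ∫⁻ t : UnitAddCircle, (v (z + circlePoint t • w)).toENNReal
      ∂AddCircle.haarAddCircle ≤ (v z).toENNReal := by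
  have hz : z ∈ Ω := by simpa using hd 0 (by simp)
  have hmem : ∀ t : UnitAddCircle, z + circlePoint t • w ∈ Ω := fun t =>
    hd _ (norm_circlePoint t).le
  have hcont : Continuous fun t : UnitAddCircle => z + circlePoint t • w := by
    have := continuous_circlePoint
    fun_prop
  refine _root_.lintegral_circle_le (g := fun t : UnitAddCircle =>
    v (z + circlePoint t • w)) ?_ (fun t => h0 _ (hmem t)) fun p hp => ?_
  · intro t c hc
    exact (tendsto_nhdsWithin_of_tendsto_nhds_of_eventually_within _ hcont.continuousAt
      (Filter.Eventually.of_forall hmem)).eventually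
      (hv.lowerSemicontinuousOn _ (hmem t) c hc)
  · have := hv.re_le hz w one_pos hd p (fun ζ hζ => ?_) (ζ := 0) (by simp)
    · simpa using this
    · obtain ⟨t, rfl⟩ := exists_circlePoint_eq hζ
      exact hp t

/-- Multiplication by a unit complex number preserves Lebesgue measure on `ℂⁿ`. -/
theorem measurePreserving_circlePoint_smul (t : UnitAddCircle) :
    MeasurePreserving (fun w : Fin n → ℂ => circlePoint t • w) volume volume :=
  volume_preserving_pi fun _ => (rotation (AddCircle.toCircle t)).measurePreserving

theorem IsPSupH.lowerReg_toENNReal (hΩ : IsOpen Ω) (hv : IsPSupH Ω v)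
    {z : Fin n → ℂ} (hz : z ∈ Ω) :
    lowerReg (fun y => (v y).toENNReal) z = (v z).toENNReal := by
  refine lowerReg_eq_of_lsc ?_
  have : LowerSemicontinuousAt v z := by
    intro c hc
    have := hv.lowerSemicontinuousOn z hz c hc
    rwa [hΩ.nhdsWithin_eq hz] at this
  exact EReal.continuous_toENNReal.continuousAt.comp_lowerSemicontinuousAt this
    fun _ _ => EReal.toENNReal_le_toENNReal

theorem IsPSupH.ballSuperMean (hΩ : IsOpen Ω) (hv : IsPSupH Ω v) (h0 : ∀ z ∈ Ω, 0 ≤ v z) :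
    BallSuperMean Ω fun z => (v z).toENNReal := by
  set V : (Fin n → ℂ) → ℝ≥0∞ := lowerReg fun z => (v z).toENNReal with hV
  have hVm : Measurable V := (lowerSemicontinuous_lowerReg _).measurable
  have hVv : ∀ z ∈ Ω, V z = (v z).toENNReal := fun z hz => hv.lowerReg_toENNReal hΩ hz
  refine BallSuperMean.congr (w := V) ?_ fun z hz => (hVv z hz).symm
  intro z r hr hball
  have hz : z ∈ Ω := hball (Metric.mem_ball_self hr)
  have hrot : ∀ t : UnitAddCircle, ∫⁻ y in Metric.ball z r, V y =
      ∫⁻ w in Metric.ball 0 r, V (z + circlePoint t • w) := by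
    intro t
    have hmp : MeasurePreserving (fun w : Fin n → ℂ => z + circlePoint t • w)
        volume volume :=
      (measurePreserving_add_left volume z).comp (measurePreserving_circlePoint_smul _)
    rw [← hmp.setLIntegral_comp_preimage measurableSet_ball hVm]
    congr 2
    ext w
    simp [norm_smul, norm_circlePoint]
  have hball' : ∀ w ∈ Metric.ball (0 : Fin n → ℂ) r, ∀ ζ : ℂ, ‖ζ‖ ≤ 1 → z + ζ • w ∈ Ω := by
    intro w hw ζ hζ
    apply hball
    rw [mem_ball_zero_iff] at hw
    rw [Metric.mem_ball, dist_eq_norm, add_sub_cancel_left, norm_smul]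
    nlinarith [norm_nonneg w]
  have hprod : Measurable fun x : UnitAddCircle × (Fin n → ℂ) =>
      V (z + circlePoint x.1 • x.2) := by
    refine hVm.comp (Continuous.measurable ?_)
    have := continuous_circlePoint
    fun_prop
  calc ∫⁻ y in Metric.ball z r, V y
      = ∫⁻ _ : UnitAddCircle, (∫⁻ y in Metric.ball z r, V y) ∂AddCircle.haarAddCircle := by simp
    _ = ∫⁻ t : UnitAddCircle, (∫⁻ w in Metric.ball 0 r,
          V (z + circlePoint t • w)) ∂AddCircle.haarAddCircle := by
        simp only [← hrot]
    _ = ∫⁻ w in Metric.ball 0 r, ∫⁻ t : UnitAddCircle,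
          V (z + circlePoint t • w) ∂AddCircle.haarAddCircle :=
        lintegral_lintegral_swap hprod.aemeasurable
    _ ≤ ∫⁻ _ in Metric.ball (0 : Fin n → ℂ) r, V z := by
        refine setLIntegral_mono' measurableSet_ball fun w hw => ?_
        rw [hVv z hz]
        refine le_trans (lintegral_mono fun t => ?_)
          (hv.lintegral_circle_le h0 (hball' w hw))
        rw [hVv _ (hball' w hw _ (norm_circlePoint t).le)]
    _ = volume (Metric.ball z r) * V z := by
        rw [setLIntegral_const, mul_comm, Measure.addHaar_ball_center volume z]

end PSupH

section Sum

variable {n : ℕ} {Ω : Set (Fin n → ℂ)} {v₁ v₂ : (Fin n → ℂ) → EReal}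

theorem exists_mem_ball_of_ae_restrict {z : Fin n → ℂ} {r : ℝ} (hr : 0 < r)
    {P : (Fin n → ℂ) → Prop} (h : ∀ᵐ y ∂volume.restrict (Metric.ball z r), P y) :
    ∃ y ∈ Metric.ball z r, P y := by
  have : NeBot (ae (volume.restrict (Metric.ball z r))) :=
    ae_restrict_neBot.2 (volume_ball_ne_zero z hr)
  exact ((ae_restrict_mem measurableSet_ball).and h).exists

/-- On a connected open set, a super-mean function that is finite somewhere is locally finite
almost everywhere. -/
theorem BallSuperMean.ae_lt_top (hΩ : IsOpen Ω) (hΩc : IsPreconnected Ω)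
    {w : (Fin n → ℂ) → ℝ≥0∞} (hw : BallSuperMean Ω w) (hwm : Measurable w)
    (hfin : ∃ z ∈ Ω, w z ≠ ∞) {z : Fin n → ℂ} (hz : z ∈ Ω) :
    ∃ r > 0, ∀ᵐ y ∂volume.restrict (Metric.ball z r), w y < ∞ := by
  have hloc : ∀ z r, 0 < r → Metric.ball z r ⊆ Ω → w z ≠ ∞ →
      ∀ᵐ y ∂volume.restrict (Metric.ball z r), w y < ∞ := fun z r hr hball hz =>
    MeasureTheory.ae_lt_top hwm
      ((hw z r hr hball).trans_lt (ENNReal.mul_lt_top measure_ball_lt_top hz.lt_top)).ne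
  set U : Set (Fin n → ℂ) :=
    {z | ∃ r > 0, ∀ᵐ y ∂volume.restrict (Metric.ball z r), w y < ∞} with hU
  have hUo : IsOpen U := by
    refine Metric.isOpen_iff.2 fun z ⟨r, hr, h⟩ => ⟨r, hr, fun y hy => ?_⟩
    rw [Metric.mem_ball] at hy
    exact ⟨r - dist y z, by linarith, ae_restrict_of_ae_restrict_of_subset
      (Metric.ball_subset_ball' (by linarith)) h⟩
  refine hΩc.subset_of_closure_inter_subset hUo ?_ ?_ hz
  · obtain ⟨x, hx, hxw⟩ := hfin
    obtain ⟨r, hr, hball⟩ := Metric.isOpen_iff.1 hΩ x hx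
    exact ⟨x, hx, r, hr, hloc x r hr hball hxw⟩
  · rintro x ⟨hxU, hx⟩
    obtain ⟨r, hr, hball⟩ := Metric.isOpen_iff.1 hΩ x hx
    obtain ⟨y, ⟨s, hs, hy⟩, hxy⟩ := Metric.mem_closure_iff.1 hxU (r / 4) (by linarith)
    have hs' : 0 < min s (r / 4) := lt_min hs (by linarith)
    obtain ⟨y', hy', hwy'⟩ := exists_mem_ball_of_ae_restrict hs'
      (ae_restrict_of_ae_restrict_of_subset (Metric.ball_subset_ball (min_le_left _ _)) hy)
    have h1 : dist y' y < r / 4 := lt_of_lt_of_le hy' (min_le_right _ _)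
    have h2 : dist y' x < r / 2 := by
      have := dist_triangle_right y' x y
      linarith
    refine ⟨r / 2 - dist y' x, by linarith, ae_restrict_of_ae_restrict_of_subset ?_
      (hloc y' (r / 2) (by linarith) ((Metric.ball_subset_ball' (by linarith)).trans hball)
        hwy'.ne)⟩
    exact Metric.ball_subset_ball' (by rw [dist_comm x y']; linarith)

theorem IsPSupH.exists_ne_top (hΩ : IsOpen Ω) (hΩc : IsPreconnected Ω) (h₁ : IsPSupH Ω v₁)
    (h₂ : IsPSupH Ω v₂) (h₁0 : ∀ z ∈ Ω, 0 ≤ v₁ z) (h₂0 : ∀ z ∈ Ω, 0 ≤ v₂ z) :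
    ∃ z ∈ Ω, v₁ z ≠ ⊤ ∧ v₂ z ≠ ⊤ := by
  have key : ∀ v : (Fin n → ℂ) → EReal, IsPSupH Ω v → (∀ z ∈ Ω, 0 ≤ v z) → ∀ z ∈ Ω,
      ∃ r > 0, ∀ᵐ y ∂volume.restrict (Metric.ball z r),
        lowerReg (fun y => (v y).toENNReal) y < ∞ := by
    intro v hv h0 z hz
    refine (hv.ballSuperMean hΩ h0).lowerReg.ae_lt_top hΩ hΩc
      (lowerSemicontinuous_lowerReg _).measurable ?_ hz
    obtain ⟨x, hx, hxv⟩ := hv.2.2.1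
    refine ⟨x, hx, ?_⟩
    rw [hv.lowerReg_toENNReal hΩ hx, EReal.toENNReal_ne_top_iff]
    exact fun h => hxv (by simp [h])
  obtain ⟨z, hz, -⟩ := h₁.2.2.1
  obtain ⟨r, hr, hball⟩ := Metric.isOpen_iff.1 hΩ z hz
  obtain ⟨r₁, hr₁, hae₁⟩ := key v₁ h₁ h₁0 z hz
  obtain ⟨r₂, hr₂, hae₂⟩ := key v₂ h₂ h₂0 z hz
  obtain ⟨y, hy, hy₁, hy₂⟩ := exists_mem_ball_of_ae_restrict (z := z)
    (lt_min hr (lt_min hr₁ hr₂))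
    ((ae_restrict_of_ae_restrict_of_subset (Metric.ball_subset_ball
      ((min_le_right _ _).trans (min_le_left _ _))) hae₁).and
    (ae_restrict_of_ae_restrict_of_subset (Metric.ball_subset_ball
      ((min_le_right _ _).trans (min_le_right _ _))) hae₂))
  have hyΩ : y ∈ Ω := hball (Metric.ball_subset_ball (min_le_left _ _) hy)
  rw [h₁.lowerReg_toENNReal hΩ hyΩ] at hy₁
  rw [h₂.lowerReg_toENNReal hΩ hyΩ] at hy₂
  exact ⟨y, hyΩ, EReal.toENNReal_ne_top_iff.1 hy₁.ne, EReal.toENNReal_ne_top_iff.1 hy₂.ne⟩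

theorem IsPSupH.re_le_add (h₁ : IsPSupH Ω v₁) (h₂ : IsPSupH Ω v₂) (h₁0 : ∀ z ∈ Ω, 0 ≤ v₁ z)
    (h₂0 : ∀ z ∈ Ω, 0 ≤ v₂ z) {z : Fin n → ℂ} (hz : z ∈ Ω) (w : Fin n → ℂ) {r : ℝ}
    (hr : 0 < r) (hd : ∀ ζ : ℂ, ‖ζ‖ ≤ r → z + ζ • w ∈ Ω) (p : Polynomial ℂ)
    (hp : ∀ ζ : ℂ, ‖ζ‖ = r →
      (((p.eval ζ).re : ℝ) : EReal) ≤ v₁ (z + ζ • w) + v₂ (z + ζ • w)) {ζ : ℂ}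
    (hζ : ‖ζ‖ ≤ r) : (((p.eval ζ).re : ℝ) : EReal) ≤ v₁ (z + ζ • w) + v₂ (z + ζ • w) := by
  suffices h : ∀ ε : ℝ, 0 < ε →
      (((p.eval ζ).re - ε : ℝ) : EReal) ≤ v₁ (z + ζ • w) + v₂ (z + ζ • w) by
    refine le_of_forall_lt fun c hc => ?_
    obtain ⟨d, hcd, hd⟩ := EReal.lt_iff_exists_real_btwn.1 hc
    have hd' := EReal.coe_lt_coe_iff.1 hd
    refine hcd.trans_le ?_
    simpa using h ((p.eval ζ).re - d) (by linarith)
  intro ε hε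
  have hnorm : ∀ t, ‖(r : ℂ) * circlePoint t‖ = r := fun t => by
    simp [norm_circlePoint, abs_of_pos hr]
  have hmem : ∀ t, z + ((r : ℂ) * circlePoint t) • w ∈ Ω := fun t => hd _ (hnorm t).le
  have hcont : Continuous fun t => z + ((r : ℂ) * circlePoint t) • w := by
    have := continuous_circlePoint
    fun_prop
  have hlsc : ∀ v : (Fin n → ℂ) → EReal, IsPSupH Ω v →
      LowerSemicontinuous fun t => v (z + ((r : ℂ) * circlePoint t) • w) := by
    intro v hv t c hc
    exact (tendsto_nhdsWithin_of_tendsto_nhds_of_eventually_within _ hcont.continuousAt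
      (Filter.Eventually.of_forall hmem)).eventually
      (hv.lowerSemicontinuousOn _ (hmem t) c hc)
  have hbot : ∀ a : EReal, 0 ≤ a → a ≠ ⊥ := fun a ha h => by simp [h] at ha
  have hφ : UpperSemicontinuous fun t =>
      (((p.eval ((r : ℂ) * circlePoint t)).re - ε : ℝ) : EReal) +
        -v₂ (z + ((r : ℂ) * circlePoint t) • w) := by
    intro t
    refine UpperSemicontinuousAt.add' ?_ ?_ ?_
    · refine (Continuous.upperSemicontinuous ?_) t
      refine continuous_coe_real_ereal.comp ?_
      have := continuous_circlePoint
      have hpc := p.continuous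
      fun_prop
    · intro c hc
      filter_upwards [hlsc v₂ h₂ t (-c) (EReal.neg_lt_comm.1 hc)] with s hs
      exact EReal.neg_lt_comm.1 hs
    · exact EReal.continuousAt_add (Or.inl (EReal.coe_ne_top _)) (Or.inl (EReal.coe_ne_bot _))
  have hlt : ∀ t, (((p.eval ((r : ℂ) * circlePoint t)).re - ε : ℝ) : EReal) +
        -v₂ (z + ((r : ℂ) * circlePoint t) • w) <
      v₁ (z + ((r : ℂ) * circlePoint t) • w) := by
    intro t
    have h3 := hp _ (hnorm t)
    have hb₁ := hbot _ (h₁0 _ (hmem t))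
    have hb₂ := hbot _ (h₂0 _ (hmem t))
    generalize v₁ (z + ((r : ℂ) * circlePoint t) • w) = a at *
    generalize v₂ (z + ((r : ℂ) * circlePoint t) • w) = b at *
    induction a with
    | bot => exact absurd rfl hb₁
    | top =>
      induction b with
      | bot => exact absurd rfl hb₂
      | top => simp
      | coe b => norm_cast; exact EReal.coe_lt_top _
    | coe a =>
      induction b with
      | bot => exact absurd rfl hb₂
      | top => simp
      | coe b =>
        norm_cast at h3 ⊢
        linarith
  obtain ⟨q, hq⟩ := exists_polynomial_re_between hφ (hlsc v₁ h₁) hlt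
  set q' : Polynomial ℂ := q.comp (Polynomial.C (r : ℂ)⁻¹ * Polynomial.X) with hq'
  have hq'_eval : ∀ t, q'.eval ((r : ℂ) * circlePoint t) = q.eval (circlePoint t) := by
    intro t
    have : (r : ℂ) ≠ 0 := by exact_mod_cast hr.ne'
    simp [hq', inv_mul_cancel_left₀ this]
  have hsphere : ∀ ζ : ℂ, ‖ζ‖ = r → ∃ t, ζ = (r : ℂ) * circlePoint t := by
    intro ζ hζ
    have hr' : (r : ℂ) ≠ 0 := by exact_mod_cast hr.ne'
    obtain ⟨t, ht⟩ := exists_circlePoint_eq (ζ := (r : ℂ)⁻¹ * ζ) (by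
      simp [hζ, abs_of_pos hr, hr.ne'])
    exact ⟨t, by rw [ht, mul_inv_cancel_left₀ hr']⟩
  have e₁ := h₁.re_le hz w hr hd q' (fun ζ hζ => by
    obtain ⟨t, rfl⟩ := hsphere ζ hζ
    rw [hq'_eval]
    exact (hq t).2.le) hζ
  have e₂ := h₂.re_le hz w hr hd (p - Polynomial.C (ε : ℂ) - q') (fun ζ hζ => by
    obtain ⟨t, rfl⟩ := hsphere ζ hζ
    have h3 := (hq t).1
    have hb := hbot _ (h₂0 _ (hmem t))
    simp only [Polynomial.eval_sub, Polynomial.eval_C, hq'_eval, Complex.sub_re,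
      Complex.ofReal_re]
    generalize v₂ (z + ((r : ℂ) * circlePoint t) • w) = a at h3 hb ⊢
    induction a with
    | bot => exact absurd rfl hb
    | top => exact le_top
    | coe a =>
      norm_cast at h3 ⊢
      linarith) hζ
  have := add_le_add e₁ e₂
  rw [← EReal.coe_add] at this
  simpa using this

theorem IsPSupH.add (hΩ : IsOpen Ω) (hΩc : IsPreconnected Ω) (h₁ : IsPSupH Ω v₁)
    (h₂ : IsPSupH Ω v₂) (h₁0 : ∀ z ∈ Ω, 0 ≤ v₁ z) (h₂0 : ∀ z ∈ Ω, 0 ≤ v₂ z) :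
    IsPSupH Ω fun z => v₁ z + v₂ z := by
  have hbot : ∀ a : EReal, 0 ≤ a → a ≠ ⊥ := fun a ha h => by simp [h] at ha
  refine ⟨?_, ?_, ?_, ?_⟩
  · intro z hz c hc
    have hb₁ := hbot _ (h₁0 z hz)
    have hb₂ := hbot _ (h₂0 z hz)
    have := LowerSemicontinuousWithinAt.add' (h₁.lowerSemicontinuousOn z hz)
      (h₂.lowerSemicontinuousOn z hz)
      (EReal.continuousAt_add (Or.inr hb₂) (Or.inl hb₁)) (-c) (EReal.neg_lt_comm.1 hc)
    filter_upwards [this] with y hy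
    exact EReal.neg_lt_comm.1 hy
  · intro z hz h
    rw [EReal.neg_eq_top_iff] at h
    exact hbot _ (add_nonneg (h₁0 z hz) (h₂0 z hz)) h
  · obtain ⟨z, hz, hz₁, hz₂⟩ := h₁.exists_ne_top hΩ hΩc h₂ h₁0 h₂0
    refine ⟨z, hz, fun h => ?_⟩
    rw [EReal.neg_eq_bot_iff] at h
    exact EReal.add_ne_top hz₁ hz₂ h
  · intro z hz w r hr hd p hp ζ hζ
    have := h₁.re_le_add h₂ h₁0 h₂0 hz w hr hd (-p) (fun ζ hζ => by
      rw [Polynomial.eval_neg, Complex.neg_re, EReal.coe_neg]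
      exact EReal.neg_le_of_neg_le (hp ζ hζ)) hζ
    rw [Polynomial.eval_neg, Complex.neg_re, EReal.coe_neg] at this
    exact EReal.neg_le_of_neg_le this

end Sum

section Reduced

variable {n : ℕ} {Ω : Set (Fin n → ℂ)} {f q : (Fin n → ℂ) → EReal}

theorem toENNReal_lscReg (hΩ : IsOpen Ω) (g : (Fin n → ℂ) → EReal) {z : Fin n → ℂ}
    (hz : z ∈ Ω) : (lscReg Ω g z).toENNReal = lowerReg (fun y => (g y).toENNReal) z := by
  rw [lscReg, hΩ.nhdsWithin_eq hz]
  exact Monotone.map_liminf_of_continuousAt (fun _ _ => EReal.toENNReal_le_toENNReal) g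
    EReal.continuous_toENNReal.continuousAt

theorem toENNReal_iInf {ι : Sort*} (g : ι → EReal) :
    (⨅ i, g i).toENNReal = ⨅ i, (g i).toENNReal :=
  Monotone.map_iInf_of_continuousAt EReal.continuous_toENNReal.continuousAt
    (fun _ _ => EReal.toENNReal_le_toENNReal) EReal.toENNReal_top

/-- The plurisuperharmonic majorants of `(f - lam)⁺` on `Ω`. -/
def Majorant (Ω : Set (Fin n → ℂ)) (f : (Fin n → ℂ) → EReal) (lam : ℝ) : Type :=
  {v : (Fin n → ℂ) → EReal // IsPSupH Ω v ∧ ∀ ζ ∈ Ω, max (f ζ - (lam : EReal)) 0 ≤ v ζ}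

theorem Majorant.nonneg {lam : ℝ} (v : Majorant Ω f lam) : ∀ z ∈ Ω, 0 ≤ v.1 z :=
  fun z hz => (le_max_right _ _).trans (v.2.2 z hz)

theorem Rop_eq_iInf (f : (Fin n → ℂ) → EReal) (lam : ℝ) (z : Fin n → ℂ) :
    Rop Ω f lam z = ⨅ v : Majorant Ω f lam, v.1 z := by
  refine congrArg sInf (Set.ext fun y => ?_)
  constructor
  · rintro ⟨v, h₁, h₂, rfl⟩
    exact ⟨⟨v, h₁, h₂⟩, rfl⟩
  · rintro ⟨v, rfl⟩
    exact ⟨v.1, v.2.1, v.2.2, rfl⟩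

theorem toENNReal_Rop (f : (Fin n → ℂ) → EReal) (lam : ℝ) (z : Fin n → ℂ) :
    (Rop Ω f lam z).toENNReal = ⨅ v : Majorant Ω f lam, (v.1 z).toENNReal := by
  rw [Rop_eq_iInf, toENNReal_iInf]

theorem ballSuperMean_Rop (hΩ : IsOpen Ω) (f : (Fin n → ℂ) → EReal) (lam : ℝ) :
    BallSuperMean Ω fun z => (Rop Ω f lam z).toENNReal := by
  simp only [toENNReal_Rop]
  exact BallSuperMean.iInf fun v => v.2.1.ballSuperMean hΩ v.nonneg

theorem ballSuperMean_Slam (hΩ : IsOpen Ω) (f : (Fin n → ℂ) → EReal) (lam : ℝ) :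
    BallSuperMean Ω fun z => (Slam Ω f lam z).toENNReal :=
  (ballSuperMean_Rop hΩ f lam).lowerReg.congr fun _ hz => toENNReal_lscReg hΩ _ hz

theorem max_sub_zero_add_le {a b : EReal} (ha : 0 ≤ a) (hb : 0 ≤ b) (s t : ℝ) :
    max (a + b - ((s + t : ℝ) : EReal)) 0 ≤
      max (a - (s : EReal)) 0 + max (b - (t : EReal)) 0 := by
  refine max_le ?_ (add_nonneg (le_max_right _ _) (le_max_right _ _))
  have key : a + b - ((s + t : ℝ) : EReal) ≤ (a - (s : EReal)) + (b - (t : EReal)) := by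
    induction a with
    | bot => simp at ha
    | top =>
      induction b with
      | bot => simp at hb
      | top => simp
      | coe b => norm_cast
    | coe a =>
      induction b with
      | bot => simp at hb
      | top => norm_cast
      | coe b => norm_cast; linarith
  exact key.trans (add_le_add (le_max_left _ _) (le_max_left _ _))

theorem toENNReal_Rop_add_le (hΩ : IsOpen Ω) (hΩc : IsPreconnected Ω) (hf : ∀ z ∈ Ω, 0 ≤ f z)
    (hq : ∀ z ∈ Ω, 0 ≤ q z) {s t : ℝ} (v : Majorant Ω q t) (z : Fin n → ℂ) :
    (Rop Ω (fun ζ => f ζ + q ζ) (s + t) z).toENNReal ≤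
      (Rop Ω f s z).toENNReal + (v.1 z).toENNReal := by
  rw [toENNReal_Rop, toENNReal_Rop, ENNReal.iInf_add]
  refine le_iInf fun w => ?_
  let x : Majorant Ω (fun ζ => f ζ + q ζ) (s + t) :=
    ⟨fun ζ => w.1 ζ + v.1 ζ, w.2.1.add hΩ hΩc v.2.1 w.nonneg v.nonneg, fun ζ hζ =>
      (max_sub_zero_add_le (hf ζ hζ) (hq ζ hζ) s t).trans
        (add_le_add (w.2.2 ζ hζ) (v.2.2 ζ hζ))⟩
  exact (iInf_le _ x).trans EReal.toENNReal_add_le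

theorem toENNReal_Slam_add_le (hΩ : IsOpen Ω) (hΩc : IsPreconnected Ω)
    (hf : ∀ z ∈ Ω, 0 ≤ f z) (hq : ∀ z ∈ Ω, 0 ≤ q z) (s t : ℝ) {z : Fin n → ℂ} (hz : z ∈ Ω) :
    (Slam Ω (fun ζ => f ζ + q ζ) (s + t) z).toENNReal ≤
      (Slam Ω f s z).toENNReal + (Slam Ω q t z).toENNReal := by
  simp only [Slam, toENNReal_lscReg hΩ _ hz]
  have h1 : ∀ y ∈ Ω, lowerReg (fun ζ => (Rop Ω (fun ζ => f ζ + q ζ) (s + t) ζ).toENNReal) y ≤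
      (Rop Ω q t y).toENNReal + lowerReg (fun ζ => (Rop Ω f s ζ).toENNReal) y := by
    intro y hy
    rw [toENNReal_Rop q, ENNReal.iInf_add]
    refine le_iInf fun v => ?_
    rw [add_comm (v.1 y).toENNReal]
    refine (lowerReg_le_add hΩ (ballSuperMean_Rop hΩ f s)
      (v.2.1.ballSuperMean hΩ v.nonneg).lowerReg
      (lowerSemicontinuous_lowerReg _).measurable (fun x hx => ?_) hy).trans
      (add_le_add_right ((lowerReg_le _ _).trans (lowerReg_le _ _)) _)
    rw [v.2.1.lowerReg_toENNReal hΩ hx]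
    exact toENNReal_Rop_add_le hΩ hΩc hf hq v x
  have h2 := lowerReg_le_add hΩ (ballSuperMean_Rop hΩ q t) (ballSuperMean_Rop hΩ f s).lowerReg
    (lowerSemicontinuous_lowerReg _).measurable h1 hz
  rw [lowerReg_lowerReg, lowerReg_lowerReg] at h2
  exact h2.trans_eq (add_comm _ _)

theorem toENNReal_Sop (hΩ : IsOpen Ω) (f : (Fin n → ℂ) → EReal) {z : Fin n → ℂ} (hz : z ∈ Ω) :
    (Sop Ω f z).toENNReal =
      lowerReg (fun y => ⨅ (lam : ℝ) (_ : 0 ≤ lam), (Slam Ω f lam y).toENNReal) z := by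
  rw [Sop, toENNReal_lscReg hΩ _ hz]
  simp only [toENNReal_iInf]

theorem toENNReal_Sop_add_le (hΩ : IsOpen Ω) (hΩc : IsPreconnected Ω)
    (hf : ∀ z ∈ Ω, 0 ≤ f z) (hq : ∀ z ∈ Ω, 0 ≤ q z) {z : Fin n → ℂ} (hz : z ∈ Ω) :
    (Sop Ω (fun ζ => f ζ + q ζ) z).toENNReal ≤
      (Sop Ω f z).toENNReal + (Sop Ω q z).toENNReal := by
  simp only [toENNReal_Sop hΩ _ hz]
  have hT : ∀ g : (Fin n → ℂ) → EReal,
      BallSuperMean Ω fun y => ⨅ (lam : ℝ) (_ : 0 ≤ lam), (Slam Ω g lam y).toENNReal :=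
    fun g => BallSuperMean.iInf fun lam => BallSuperMean.iInf fun _ => ballSuperMean_Slam hΩ g lam
  have h1 : ∀ t : ℝ, 0 ≤ t → ∀ y ∈ Ω,
      (⨅ (lam : ℝ) (_ : 0 ≤ lam), (Slam Ω (fun ζ => f ζ + q ζ) lam y).toENNReal) ≤
      (⨅ (lam : ℝ) (_ : 0 ≤ lam), (Slam Ω f lam y).toENNReal) +
        lowerReg (fun ζ => (Rop Ω q t ζ).toENNReal) y := by
    intro t ht y hy
    rw [ENNReal.iInf₂_add]
    refine le_iInf₂ fun s hs => (iInf₂_le (s + t) (add_nonneg hs ht)).trans ?_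
    rw [← toENNReal_lscReg hΩ _ hy]
    exact toENNReal_Slam_add_le hΩ hΩc hf hq s t hy
  have h2 : ∀ y ∈ Ω,
      lowerReg (fun y => ⨅ (lam : ℝ) (_ : 0 ≤ lam),
        (Slam Ω (fun ζ => f ζ + q ζ) lam y).toENNReal) y ≤
      (⨅ (lam : ℝ) (_ : 0 ≤ lam), (Slam Ω q lam y).toENNReal) +
        lowerReg (fun y => ⨅ (lam : ℝ) (_ : 0 ≤ lam), (Slam Ω f lam y).toENNReal) y := by
    intro y hy
    rw [ENNReal.iInf₂_add]
    refine le_iInf₂ fun t ht => ?_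
    have := lowerReg_le_add hΩ (hT f) (ballSuperMean_Rop hΩ q t).lowerReg
      (lowerSemicontinuous_lowerReg _).measurable (h1 t ht) hy
    rw [lowerReg_lowerReg, ← toENNReal_lscReg hΩ (Rop Ω q t) hy] at this
    exact this.trans_eq (add_comm _ _)
  have h3 := lowerReg_le_add hΩ (hT q) (hT f).lowerReg
    (lowerSemicontinuous_lowerReg _).measurable h2 hz
  rw [lowerReg_lowerReg, lowerReg_lowerReg] at h3
  exact h3.trans_eq (add_comm _ _)

theorem lscReg_mono {g h : (Fin n → ℂ) → EReal} (hgh : ∀ z ∈ Ω, g z ≤ h z)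
    (z : Fin n → ℂ) : lscReg Ω g z ≤ lscReg Ω h z :=
  liminf_le_liminf (eventually_mem_nhdsWithin.mono hgh)

theorem Rop_mono (hfq : ∀ z ∈ Ω, f z ≤ q z) (lam : ℝ) (z : Fin n → ℂ) :
    Rop Ω f lam z ≤ Rop Ω q lam z := by
  refine sInf_le_sInf ?_
  rintro y ⟨v, hv, hvq, rfl⟩
  exact ⟨v, hv, fun ζ hζ => (max_le_max_right _
    (EReal.sub_le_sub (hfq ζ hζ) le_rfl)).trans (hvq ζ hζ), rfl⟩

theorem Sop_mono (hfq : ∀ z ∈ Ω, f z ≤ q z) (z : Fin n → ℂ) : Sop Ω f z ≤ Sop Ω q z :=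
  lscReg_mono (fun _ _ => iInf₂_mono fun lam _ =>
    lscReg_mono (fun y _ => Rop_mono hfq lam y) _) z

theorem lscReg_nonneg {g : (Fin n → ℂ) → EReal} (hg : ∀ z ∈ Ω, 0 ≤ g z) (z : Fin n → ℂ) :
    0 ≤ lscReg Ω g z :=
  le_liminf_of_le (by isBoundedDefault) (eventually_mem_nhdsWithin.mono hg)

theorem Sop_nonneg (f : (Fin n → ℂ) → EReal) (z : Fin n → ℂ) : 0 ≤ Sop Ω f z := by
  refine lscReg_nonneg (fun y _ => le_iInf₂ fun lam _ => lscReg_nonneg (fun x hx => ?_) y) z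
  rw [Rop_eq_iInf]
  exact le_iInf fun v => v.nonneg x hx

end Reduced

/-- Lemma 2.3: for a bounded domain `Ω ⊆ ℂⁿ` and `f, q ∈ ℳ` with `q`
tame, one has `S(f + q) = S f` everywhere on `Ω`. -/
theorem statement4 {n : ℕ} (Ω : Set (Fin n → ℂ))
    (hΩo : IsOpen Ω) (hΩc : IsConnected Ω) (hΩb : Bornology.IsBounded Ω)
    (f q : (Fin n → ℂ) → EReal) (hf : MemM Ω f) (hq : MemM Ω q) (hqt : Tame Ω q) :
    ∀ z ∈ Ω, Sop Ω (fun ζ => f ζ + q ζ) z = Sop Ω f z := by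
  intro z hz
  refine le_antisymm ?_ (Sop_mono (fun ζ hζ => le_add_of_nonneg_right (hq.1 ζ hζ)) z)
  have h := toENNReal_Sop_add_le hΩo hΩc.isPreconnected hf.1 hq.1 hz
  rw [hqt z hz, EReal.toENNReal_zero, add_zero] at h
  rw [← EReal.coe_toENNReal (Sop_nonneg (fun ζ => f ζ + q ζ) z),
    ← EReal.coe_toENNReal (Sop_nonneg f z)]
  exact EReal.coe_ennreal_le_coe_ennreal_iff.2 h
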